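/- Let G = G1 ×_I G2 be a discrete cusp with I ⊆ V2 nonempty, assume Hol_{θ2} ≠ 0, and set M := (sup_{x∈V1} deg_{G1}(x)) · (max_{y∈V2} 1/m2(y)). Then: D(Δ_{G,θ}^{1/2}) = D(deg_G^{1/2}(·)); for every λ ≥ 0, N_{λ−2M}(m1^{-1}(·) ⊗ Δ_{G2,θ2}) ≤ N_λ(Δ_{G,θ}) ≤ N_λ(m1^{-1}(·) ⊗ Δ_{G2,θ2}); and lim_{n→∞} λ_n(Δ_{G,θ}) / λ_n(m1^{-1}(·) ⊗ Δ_{G2,θ2}) = 1. -/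

import Mathlib

open scoped BigOperators ENNReal

noncomputable section

namespace MagneticCusp

attribute [local instance] Classical.propDecidable

variable {V V1 V2 : Type*}

/-- The axioms of a weighted graph `(E, V, m)`: `E` is symmetric, non-negative,
with no loops, `m` is a positive weight, and the graph is locally finite. -/
def GraphAxioms (E : V → V → ℝ) (m : V → ℝ) : Prop :=
  (∀ x y, E x y = E y x) ∧ (∀ x y, 0 ≤ E x y) ∧ (∀ x, E x x = 0) ∧ (∀ x, 0 < m x) ∧
    ∀ x, {y | 0 < E x y}.Finite

/-- Connectedness of the graph with edge weight `E`. -/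
def Conn (E : V → V → ℝ) : Prop :=
  ∀ x y, Relation.ReflTransGen (fun a b => 0 < E a b) x y

/-- A (real representative of a) magnetic potential: antisymmetric, vanishing off edges. -/
def MagneticPotential (E θ : V → V → ℝ) : Prop :=
  (∀ x y, θ y x = -θ x y) ∧ ∀ x y, E x y = 0 → θ x y = 0

/-- `γ` is a cycle of length `N` in the graph with edge weight `E`. -/
def IsCycle (E : V → V → ℝ) (γ : ℕ → V) (N : ℕ) : Prop :=
  γ N = γ 0 ∧ ∀ i < N, 0 < E (γ i) (γ (i + 1))

/-- The holonomy (flux) of the magnetic potential `θ` along `γ` (a real representative;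
it is to be considered modulo `2π`). -/
def hol (θ : V → V → ℝ) (γ : ℕ → V) (N : ℕ) : ℝ :=
  ∑ i ∈ Finset.range N, θ (γ i) (γ (i + 1))

/-- `Hol_θ = 0`: every cycle has vanishing holonomy in `ℝ/2πℤ`. -/
def HolTrivial (E θ : V → V → ℝ) : Prop :=
  ∀ (γ : ℕ → V) (N : ℕ), IsCycle E γ N → ∃ k : ℤ, hol θ γ N = 2 * Real.pi * k

/-- The magnetic Laplacian `Δ_{G,θ}` acting on functions. -/
def lap (E : V → V → ℝ) (m : V → ℝ) (θ : V → V → ℝ) (f : V → ℂ) (x : V) : ℂ :=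
  ((m x : ℝ) : ℂ)⁻¹ *
    ∑' y, ((E x y : ℝ) : ℂ) * (f x - Complex.exp (((θ x y : ℝ) : ℂ) * Complex.I) * f y)

/-- The magnetic quadratic form `Q_{G,θ}`. -/
def quadForm (E θ : V → V → ℝ) (f : V → ℂ) : ℝ :=
  (1 / 2) * ∑' x, ∑' y, E x y * ‖f x - Complex.exp (((θ x y : ℝ) : ℂ) * Complex.I) * f y‖ ^ 2

/-- The degree `deg_G(x) = m(x)⁻¹ Σ_y E(x,y)`. -/
def degree (E : V → V → ℝ) (m : V → ℝ) (x : V) : ℝ := (m x)⁻¹ * ∑' y, E x y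

/-- The squared norm of `f` in `ℓ²(V,m)`. -/
def nrmSq (m : V → ℝ) (f : V → ℂ) : ℝ := ∑' x, m x * ‖f x‖ ^ 2

/-- Membership in `ℓ²(V,m)`. -/
def MemL2 (m : V → ℝ) (f : V → ℂ) : Prop := Summable fun x => m x * ‖f x‖ ^ 2

/-- The quadratic form `⟨f, deg_G(·) f⟩` of the multiplication operator by the degree. -/
def degForm (E : V → V → ℝ) (m : V → ℝ) (f : V → ℂ) : ℝ :=
  ∑' x, m x * degree E m x * ‖f x‖ ^ 2

/-- Weight of the product of two weighted graphs. -/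
def prodM (m1 : V1 → ℝ) (m2 : V2 → ℝ) : V1 × V2 → ℝ := fun p => m1 p.1 * m2 p.2

/-- Edge weight of the product of `G1` by `G2` through `I ⊆ V2`. -/
def prodE (E1 : V1 → V1 → ℝ) (E2 : V2 → V2 → ℝ) (I : Set V2) :
    V1 × V2 → V1 × V2 → ℝ := fun p q =>
  (if p.2 = q.2 ∧ p.2 ∈ I then E1 p.1 q.1 else 0) + (if p.1 = q.1 then E2 p.2 q.2 else 0)

/-- Edge weight of the Cartesian product of `G1` by `G2`. -/
def cartE (E1 : V1 → V1 → ℝ) (m1 : V1 → ℝ) (E2 : V2 → V2 → ℝ) (m2 : V2 → ℝ) :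
    V1 × V2 → V1 × V2 → ℝ := fun p q =>
  (if p.2 = q.2 then E1 p.1 q.1 * m2 p.2 else 0) + (if p.1 = q.1 then m1 p.1 * E2 p.2 q.2 else 0)

/-- Magnetic potential of the product of `G1` by `G2`. -/
def prodTheta (θ1 : V1 → V1 → ℝ) (θ2 : V2 → V2 → ℝ) : V1 × V2 → V1 × V2 → ℝ := fun p q =>
  (if p.2 = q.2 then θ1 p.1 q.1 else 0) + (if p.1 = q.1 then θ2 p.2 q.2 else 0)

/-- Hypothesis (H1): `m1(x) → 0` as `x → ∞` (on an infinite vertex set). -/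
def H1cond (m1 : V1 → ℝ) : Prop :=
  Infinite V1 ∧ ∀ ε : ℝ, 0 < ε → {x : V1 | ε ≤ m1 x}.Finite

/-- Hypothesis (H3): the degree of `G1` is bounded. -/
def H3cond (E1 : V1 → V1 → ℝ) (m1 : V1 → ℝ) : Prop :=
  ∃ d : ℝ, ∀ x, degree E1 m1 x ≤ d

/-- The quadratic form of the operator `m1⁻¹(·) ⊗ Δ_{G2,θ2}` on `ℓ²(V1 × V2, m1 ⊗ m2)`:
`⟨f, (m1⁻¹(·) ⊗ Δ_{G2,θ2}) f⟩ = Σ_x Q_{G2,θ2}(f(x,·))`. -/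
def fiberForm (E2 θ2 : V2 → V2 → ℝ) (f : V1 × V2 → ℂ) : ℝ :=
  ∑' x : V1, quadForm E2 θ2 fun y => f (x, y)

/-- A simple cycle: closed walk of length `≥ 3` with pairwise distinct vertices. -/
def IsSimpleCycle (E : V → V → ℝ) (γ : ℕ → V) (N : ℕ) : Prop :=
  3 ≤ N ∧ γ N = γ 0 ∧ (∀ i < N, 0 < E (γ i) (γ (i + 1))) ∧
    ∀ i < N, ∀ j < N, γ i = γ j → i = j

/-- The weighted length of an edge, `L_G(x,y) = sqrt(min(m x, m y)/E x y)`. -/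
def edgeLength (E : V → V → ℝ) (m : V → ℝ) (x y : V) : ℝ :=
  Real.sqrt (min (m x) (m y) / E x y)

/-- The weighted length of a cycle. -/
def cycleLength (E : V → V → ℝ) (m : V → ℝ) (γ : ℕ → V) (N : ℕ) : ℝ :=
  ∑ i ∈ Finset.range N, edgeLength E m (γ i) (γ (i + 1))

/-- The (weighted) girth: infimum of the weighted lengths of simple cycles (`∞` if none). -/
def girth (E : V → V → ℝ) (m : V → ℝ) : ℝ≥0∞ :=
  ⨅ c : {c : (ℕ → V) × ℕ // IsSimpleCycle E c.1 c.2},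
    ENNReal.ofReal (cycleLength E m c.1.1 c.1.2)

/-- The radius of injectivity: half the girth. -/
def injRad (E : V → V → ℝ) (m : V → ℝ) : ℝ≥0∞ := girth E m / 2

/-- Min-max encoding: there is an `n`-dimensional subspace of finitely supported
functions (the form core) on which `Q ≤ lam ‖·‖²_{ℓ²(V,m)}`.  For the self-adjoint
operator associated to the form `Q` with form core `C_c(V)` this says
`N_lam(H) = dim ran 1_{(-∞,lam]}(H) ≥ n`. -/
def DimGE (Q : (V → ℂ) → ℝ) (m : V → ℝ) (lam : ℝ) (n : ℕ) : Prop :=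
  ∃ g : Fin n → V → ℂ, LinearIndependent ℂ g ∧
    (∀ i, (Function.support (g i)).Finite) ∧
    ∀ f ∈ Submodule.span ℂ (Set.range g), Q f ≤ lam * nrmSq m f

/-- Compact resolvent (equivalently: empty essential spectrum) of the non-negative
self-adjoint operator associated to the form `Q`, encoded via min-max:
`N_lam(H) < ∞` for every `lam`. -/
def CompactResolvent (Q : (V → ℂ) → ℝ) (m : V → ℝ) : Prop :=
  ∀ lam : ℝ, ∃ n : ℕ, ∀ k : ℕ, DimGE Q m lam k → k ≤ n

/-- The eigenvalue counting function `N_lam(H) = dim ran 1_{(-∞,lam]}(H)`,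
encoded via min-max over the form core. -/
def countEig (Q : (V → ℂ) → ℝ) (m : V → ℝ) (lam : ℝ) : ℕ :=
  sSup {k : ℕ | DimGE Q m lam k}

/-- The `n`-th eigenvalue (counted with multiplicity, `n` starting at `0`) of the
self-adjoint operator associated to `Q`, via the Courant min-max principle. -/
def eigVal (Q : (V → ℂ) → ℝ) (m : V → ℝ) (n : ℕ) : ℝ :=
  sInf {t : ℝ | DimGE Q m t (n + 1)}

/-- Equality of the form domains of the two non-negative forms `Q1`, `Q2`, both with
form core the finitely supported functions: by the closed graph theorem this is
equivalent to the equivalence of the form norms on the common core. -/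
def SameFormDomain (Q1 Q2 : (V → ℂ) → ℝ) (m : V → ℝ) : Prop :=
  ∃ c1 c2 : ℝ, 0 < c1 ∧ 0 < c2 ∧ ∀ f : V → ℂ, (Function.support f).Finite →
    c1 * (nrmSq m f + Q1 f) ≤ nrmSq m f + Q2 f ∧
      nrmSq m f + Q2 f ≤ c2 * (nrmSq m f + Q1 f)

/-- The summand of the magnetic quadratic form. -/
def energy (E θ : V → V → ℝ) (f : V → ℂ) (x y : V) : ℝ :=
  E x y * ‖f x - Complex.exp (((θ x y : ℝ) : ℂ) * Complex.I) * f y‖ ^ 2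

theorem energy_nonneg {E : V → V → ℝ} (hE : ∀ x y, 0 ≤ E x y) (θ : V → V → ℝ) (f : V → ℂ)
    (x y : V) : 0 ≤ energy E θ f x y :=
  mul_nonneg (hE x y) (by positivity)

theorem quadForm_nonneg {E : V → V → ℝ} (hE : ∀ x y, 0 ≤ E x y) (θ : V → V → ℝ) (f : V → ℂ) :
    0 ≤ quadForm E θ f :=
  mul_nonneg (by norm_num) (tsum_nonneg fun x => tsum_nonneg fun y => energy_nonneg hE θ f x y)

theorem quadForm_zero (E θ : V → V → ℝ) : quadForm E θ (fun _ => 0) = 0 := by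
  simp [quadForm]

/-- The quadratic form of `f` is a finite sum over any finite set `S` containing the support
of `f` and all its neighbors. -/
theorem quadForm_eq_sum {E : V → V → ℝ} (θ : V → V → ℝ) {f : V → ℂ} {S : Finset V}
    (hS : ∀ x y, x ∉ S ∨ y ∉ S → E x y = 0 ∨ (f x = 0 ∧ f y = 0)) :
    quadForm E θ f = (1 / 2) * ∑ x ∈ S, ∑ y ∈ S, energy E θ f x y := by
  have h0 : ∀ x y, x ∉ S ∨ y ∉ S → energy E θ f x y = 0 := by
    intro x y h
    rcases hS x y h with h | ⟨h, h'⟩ <;> simp [energy, *]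
  unfold quadForm
  congr 1
  rw [tsum_eq_sum (s := S)]
  · refine Finset.sum_congr rfl fun x _ => ?_
    exact tsum_eq_sum fun y hy => h0 x y (Or.inr hy)
  · intro x hx
    exact (tsum_congr fun y => h0 x y (Or.inl hx)).trans tsum_zero

/-- A finite set is contained in a finite set which also contains all its neighbors. -/
theorem exists_finset_neighbors {E : V → V → ℝ} {m : V → ℝ} (hG : GraphAxioms E m)
    {s : Set V} (hs : s.Finite) :
    ∃ S : Finset V, s ⊆ S ∧ ∀ x y, x ∉ S ∨ y ∉ S → E x y = 0 ∨ (x ∉ s ∧ y ∉ s) := by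
  obtain ⟨hsym, hnn, -, -, hlf⟩ := hG
  have hfin : (s ∪ ⋃ x ∈ s, {y | 0 < E x y}).Finite :=
    hs.union (hs.biUnion fun x _ => hlf x)
  refine ⟨hfin.toFinset, by intro x hx; simp [hx], fun x y h => ?_⟩
  by_contra! hcon
  obtain ⟨hne, himp⟩ := hcon
  have hpos : 0 < E x y := lt_of_le_of_ne (hnn x y) (Ne.symm hne)
  have hpos' : 0 < E y x := hsym x y ▸ hpos
  simp only [Set.Finite.mem_toFinset, Set.mem_union, Set.mem_iUnion, Set.mem_ofPred_eq,
    not_or, not_exists] at h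
  by_cases hx : x ∈ s
  · rcases h with h | h
    · exact h.1 hx
    · exact h.2 x hx hpos
  · have hy := himp hx
    rcases h with h | h
    · exact h.2 y hy hpos'
    · exact h.1 hy

theorem exists_finset_quadForm {E : V → V → ℝ} {m : V → ℝ} (hG : GraphAxioms E m)
    {f : V → ℂ} (hf : (Function.support f).Finite) :
    ∃ S : Finset V, Function.support f ⊆ S ∧
      ∀ x y, x ∉ S ∨ y ∉ S → E x y = 0 ∨ (f x = 0 ∧ f y = 0) := by
  obtain ⟨S, h1, h2⟩ := exists_finset_neighbors hG hf
  exact ⟨S, h1, by simpa using h2⟩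

theorem summable_edge {E : V → V → ℝ} {m : V → ℝ} (hG : GraphAxioms E m) (x : V) :
    Summable (E x) := by
  refine summable_of_hasFiniteSupport ((hG.2.2.2.2 x).subset fun y hy => ?_)
  exact lt_of_le_of_ne (hG.2.1 x y) (Ne.symm hy)

theorem mul_degree {m : V → ℝ} (hm : ∀ x, 0 < m x) (E : V → V → ℝ) (x : V) :
    m x * degree E m x = ∑' y, E x y := by
  rw [degree, mul_inv_cancel_left₀ (hm x).ne']

theorem degree_nonneg {E : V → V → ℝ} {m : V → ℝ} (hG : GraphAxioms E m) (x : V) :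
    0 ≤ degree E m x :=
  mul_nonneg (inv_nonneg.2 (hG.2.2.2.1 x).le) (tsum_nonneg (hG.2.1 x))

theorem tsum_mul_norm_sq_eq_sum (w : V → ℝ) {f : V → ℂ} {S : Finset V}
    (hS : Function.support f ⊆ S) : ∑' x, w x * ‖f x‖ ^ 2 = ∑ x ∈ S, w x * ‖f x‖ ^ 2 :=
  tsum_eq_sum fun x hx => by
    have : f x = 0 := by
      by_contra h
      exact hx (hS h)
    simp [this]

theorem nrmSq_nonneg {m : V → ℝ} (hm : ∀ x, 0 < m x) (f : V → ℂ) : 0 ≤ nrmSq m f :=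
  tsum_nonneg fun x => mul_nonneg (hm x).le (by positivity)

theorem degForm_nonneg {E : V → V → ℝ} {m : V → ℝ} (hG : GraphAxioms E m) (f : V → ℂ) :
    0 ≤ degForm E m f :=
  tsum_nonneg fun x =>
    mul_nonneg (mul_nonneg (hG.2.2.2.1 x).le (degree_nonneg hG x)) (by positivity)

theorem norm_sub_exp_mul_sq_le (a b : ℂ) (t : ℝ) :
    ‖a - Complex.exp ((t : ℂ) * Complex.I) * b‖ ^ 2 ≤ 2 * (‖a‖ ^ 2 + ‖b‖ ^ 2) := by
  have h : ‖a - Complex.exp ((t : ℂ) * Complex.I) * b‖ ≤ ‖a‖ + ‖b‖ := by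
    refine (norm_sub_le _ _).trans_eq ?_
    rw [norm_mul, Complex.norm_exp_ofReal_mul_I, one_mul]
  nlinarith [norm_nonneg (a - Complex.exp ((t : ℂ) * Complex.I) * b), sq_nonneg (‖a‖ - ‖b‖)]

theorem quadForm_le_two_mul_degForm {E : V → V → ℝ} {m : V → ℝ} (hG : GraphAxioms E m)
    (θ : V → V → ℝ) {f : V → ℂ} (hf : (Function.support f).Finite) :
    quadForm E θ f ≤ 2 * degForm E m f := by
  obtain ⟨S, hfS, hS⟩ := exists_finset_quadForm hG hf
  rw [quadForm_eq_sum θ hS, degForm, tsum_mul_norm_sq_eq_sum _ hfS]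
  have h1 : ∑ x ∈ S, ∑ y ∈ S, energy E θ f x y ≤
      ∑ x ∈ S, ∑ y ∈ S, (2 * (E x y * ‖f x‖ ^ 2) + 2 * (E x y * ‖f y‖ ^ 2)) := by
    refine Finset.sum_le_sum fun x _ => Finset.sum_le_sum fun y _ => ?_
    have := mul_le_mul_of_nonneg_left (norm_sub_exp_mul_sq_le (f x) (f y) (θ x y)) (hG.2.1 x y)
    unfold energy
    linarith
  have h2 : ∑ x ∈ S, ∑ y ∈ S, E x y * ‖f y‖ ^ 2 = ∑ x ∈ S, ∑ y ∈ S, E x y * ‖f x‖ ^ 2 := by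
    rw [Finset.sum_comm]
    exact Finset.sum_congr rfl fun x _ => Finset.sum_congr rfl fun y _ => by rw [hG.1]
  have h3 : ∑ x ∈ S, ∑ y ∈ S, E x y * ‖f x‖ ^ 2 ≤ ∑ x ∈ S, m x * degree E m x * ‖f x‖ ^ 2 := by
    refine Finset.sum_le_sum fun x _ => ?_
    rw [← Finset.sum_mul, mul_degree hG.2.2.2.1]
    exact mul_le_mul_of_nonneg_right
      ((summable_edge hG x).sum_le_tsum S fun y _ => hG.2.1 x y) (by positivity)
  simp only [Finset.sum_add_distrib, ← Finset.mul_sum] at h1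
  linarith

/-! The quadratic form of a finite graph with non-trivial holonomy is positive definite. -/

theorem eq_exp_hol_mul {E θ : V → V → ℝ} {g : V → ℂ}
    (hg : ∀ x y, 0 < E x y → g x = Complex.exp (((θ x y : ℝ) : ℂ) * Complex.I) * g y)
    (γ : ℕ → V) (N : ℕ) (hγ : ∀ i < N, 0 < E (γ i) (γ (i + 1))) :
    g (γ 0) = Complex.exp (((hol θ γ N : ℝ) : ℂ) * Complex.I) * g (γ N) := by
  induction N with
  | zero => simp [hol]
  | succ N ih =>
    rw [ih fun i hi => hγ i (hi.trans N.lt_succ_self), hg _ _ (hγ N N.lt_succ_self), ← mul_assoc,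
      ← Complex.exp_add]
    simp [hol, Finset.sum_range_succ, add_mul]

theorem eq_zero_of_not_holTrivial {E θ : V → V → ℝ} (hconn : Conn E) (hhol : ¬HolTrivial E θ)
    {g : V → ℂ}
    (hg : ∀ x y, 0 < E x y → g x = Complex.exp (((θ x y : ℝ) : ℂ) * Complex.I) * g y) :
    g = 0 := by
  simp only [HolTrivial, not_forall] at hhol
  obtain ⟨γ, N, ⟨hclosed, hγ⟩, hk⟩ := hhol
  have h0 : g (γ 0) = 0 := by
    by_contra hne
    have h := eq_exp_hol_mul hg γ N hγ
    rw [hclosed] at h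
    have hexp : Complex.exp (((hol θ γ N : ℝ) : ℂ) * Complex.I) = 1 :=
      mul_right_cancel₀ hne (by rw [one_mul]; exact h.symm)
    obtain ⟨n, hn⟩ := Complex.exp_eq_one_iff.1 hexp
    refine hk ⟨n, ?_⟩
    have h2 : ((hol θ γ N : ℝ) : ℂ) = ((2 * Real.pi * n : ℝ) : ℂ) := by
      apply mul_right_cancel₀ Complex.I_ne_zero
      rw [hn]
      push_cast
      ring
    exact_mod_cast h2
  funext x
  induction hconn (γ 0) x with
  | refl => exact h0
  | tail _ hE ih =>
    have h := hg _ _ hE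
    rw [ih] at h
    simpa [Complex.exp_ne_zero] using h.symm

theorem quadForm_pos [Fintype V] {E θ : V → V → ℝ} {m : V → ℝ} (hG : GraphAxioms E m)
    (hconn : Conn E) (hhol : ¬HolTrivial E θ) {g : V → ℂ} (hg : g ≠ 0) :
    0 < quadForm E θ g := by
  refine lt_of_le_of_ne (quadForm_nonneg hG.2.1 θ g) fun h => hg ?_
  refine eq_zero_of_not_holTrivial hconn hhol fun x y hxy => ?_
  rw [quadForm_eq_sum (S := Finset.univ) θ (by simp)] at h
  have h' : ∑ x, ∑ y, energy E θ g x y = 0 := by linarith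
  rw [Finset.sum_eq_zero_iff_of_nonneg
    fun x _ => Finset.sum_nonneg fun y _ => energy_nonneg hG.2.1 θ g x y] at h'
  have hx := h' x (Finset.mem_univ x)
  rw [Finset.sum_eq_zero_iff_of_nonneg fun y _ => energy_nonneg hG.2.1 θ g x y] at hx
  have hy := hx y (Finset.mem_univ y)
  rw [energy, mul_eq_zero, or_iff_right hxy.ne', sq_eq_zero_iff, norm_eq_zero, sub_eq_zero] at hy
  exact hy

theorem quadForm_smul (E θ : V → V → ℝ) (c : ℂ) (g : V → ℂ) :
    quadForm E θ (c • g) = ‖c‖ ^ 2 * quadForm E θ g := by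
  unfold quadForm
  rw [mul_left_comm]
  congr 1
  rw [← tsum_mul_left]
  refine tsum_congr fun x => ?_
  rw [← tsum_mul_left]
  refine tsum_congr fun y => ?_
  have : (c • g) x - Complex.exp (((θ x y : ℝ) : ℂ) * Complex.I) * (c • g) y =
      c * (g x - Complex.exp (((θ x y : ℝ) : ℂ) * Complex.I) * g y) := by
    simp only [Pi.smul_apply, smul_eq_mul]
    ring
  rw [this, norm_mul]
  ring

theorem exists_pos_mul_sum_le_quadForm [Fintype V] {E θ : V → V → ℝ} {m : V → ℝ}
    (hG : GraphAxioms E m) (hconn : Conn E) (hhol : ¬HolTrivial E θ) :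
    ∃ c : ℝ, 0 < c ∧ ∀ g : V → ℂ, c * ∑ y, ‖g y‖ ^ 2 ≤ quadForm E θ g := by
  rcases isEmpty_or_nonempty V with hV | hV
  · exact ⟨1, one_pos, fun g => by simpa using quadForm_nonneg hG.2.1 θ g⟩
  have hcont : Continuous fun g : V → ℂ => quadForm E θ g := by
    have : (fun g : V → ℂ => quadForm E θ g) =
        fun g => (1 / 2) * ∑ x, ∑ y, energy E θ g x y := by
      funext g
      exact quadForm_eq_sum (S := Finset.univ) θ (by simp)
    rw [this]
    unfold energy
    fun_prop
  obtain ⟨g₀, hg₀, hmin⟩ := (isCompact_sphere (0 : V → ℂ) 1).exists_isMinOn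
    (NormedSpace.sphere_nonempty.2 zero_le_one) hcont.continuousOn
  have hg₀' : g₀ ≠ 0 := by
    rintro rfl
    simp at hg₀
  have hpos := quadForm_pos hG hconn hhol hg₀'
  have hcard : (0 : ℝ) < Fintype.card V := by exact_mod_cast Fintype.card_pos
  refine ⟨quadForm E θ g₀ / Fintype.card V, by positivity, fun g => ?_⟩
  have hsum : ∑ y, ‖g y‖ ^ 2 ≤ Fintype.card V * ‖g‖ ^ 2 := by
    refine (Finset.sum_le_card_nsmul _ _ (‖g‖ ^ 2) fun y _ => ?_).trans_eq (by simp)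
    exact pow_le_pow_left₀ (norm_nonneg _) (norm_le_pi_norm g y) 2
  have hq : quadForm E θ g₀ * ‖g‖ ^ 2 ≤ quadForm E θ g := by
    by_cases hg : g = 0
    · subst hg
      simpa using quadForm_nonneg hG.2.1 θ 0
    have hn : (0 : ℝ) < ‖g‖ := norm_pos_iff.2 hg
    have hmem : ((‖g‖⁻¹ : ℝ) : ℂ) • g ∈ Metric.sphere (0 : V → ℂ) 1 := by
      rw [mem_sphere_zero_iff_norm, norm_smul, Complex.norm_real, norm_inv, norm_norm,
        inv_mul_cancel₀ hn.ne']
    have h := hmin hmem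
    simp only [Set.mem_ofPred_eq, quadForm_smul, Complex.norm_real, norm_inv, norm_norm] at h
    have h' := mul_le_mul_of_nonneg_right h (sq_nonneg ‖g‖)
    rwa [mul_right_comm, inv_pow, inv_mul_cancel₀ (by positivity), one_mul] at h'
  calc quadForm E θ g₀ / Fintype.card V * ∑ y, ‖g y‖ ^ 2
      ≤ quadForm E θ g₀ / Fintype.card V * (Fintype.card V * ‖g‖ ^ 2) := by gcongr
    _ = quadForm E θ g₀ * ‖g‖ ^ 2 := by field_simp
    _ ≤ _ := hq

/-! Decomposition of the quadratic form of a product. -/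

/-- The part of the quadratic form of the product carried by the edges of `G1`. -/
def horizontalForm [Fintype V2] (E1 θ1 : V1 → V1 → ℝ) (I : Set V2) (f : V1 × V2 → ℂ) : ℝ :=
  ∑ y : V2, if y ∈ I then quadForm E1 θ1 fun x => f (x, y) else 0

theorem graphAxioms_prod [Finite V2] {E1 : V1 → V1 → ℝ} {m1 : V1 → ℝ} {E2 : V2 → V2 → ℝ}
    {m2 : V2 → ℝ} (I : Set V2) (hG1 : GraphAxioms E1 m1) (hG2 : GraphAxioms E2 m2) :
    GraphAxioms (prodE E1 E2 I) (prodM m1 m2) := by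
  obtain ⟨hs1, hn1, hl1, hm1, hf1⟩ := hG1
  obtain ⟨hs2, hn2, hl2, hm2, -⟩ := hG2
  refine ⟨fun p q => ?_, fun p q => ?_, fun p => ?_, fun p => mul_pos (hm1 _) (hm2 _), fun p => ?_⟩
  · unfold prodE
    rw [hs1 p.1 q.1, hs2 p.2 q.2]
    congr 1
    · refine if_congr ⟨?_, ?_⟩ rfl rfl <;> rintro ⟨h, h'⟩ <;> exact ⟨h.symm, h ▸ h'⟩
    · exact if_congr eq_comm rfl rfl
  · unfold prodE
    refine add_nonneg ?_ ?_ <;> split_ifs <;> first | exact hn1 _ _ | exact hn2 _ _ | exact le_rfl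
  · simp [prodE, hl1, hl2]
  · refine (((hf1 p.1).insert p.1).prod (Set.finite_univ (α := V2))).subset fun q hq => ?_
    refine Set.mem_prod.2 ⟨?_, Set.mem_univ _⟩
    by_contra hcon
    simp only [Set.mem_insert_iff, Set.mem_ofPred_eq, not_or, not_lt] at hcon
    have h0 : E1 p.1 q.1 = 0 := le_antisymm hcon.2 (hn1 _ _)
    have : prodE E1 E2 I p q = 0 := by
      simp [prodE, h0, Ne.symm hcon.1]
    exact hq.ne' this

theorem finite_support_slice {f : V1 × V2 → ℂ} (hf : (Function.support f).Finite) (y : V2) :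
    (Function.support fun x => f (x, y)).Finite :=
  (hf.image Prod.fst).subset fun x hx => ⟨(x, y), hx, rfl⟩

theorem energy_prod {E1 θ1 : V1 → V1 → ℝ} {E2 θ2 : V2 → V2 → ℝ} (I : Set V2)
    (h1 : ∀ x, E1 x x = 0) (h2 : ∀ y, E2 y y = 0) (f : V1 × V2 → ℂ) (x x' : V1) (y y' : V2) :
    energy (prodE E1 E2 I) (prodTheta θ1 θ2) f (x, y) (x', y') =
      (if y = y' then if y ∈ I then energy E1 θ1 (fun x => f (x, y)) x x' else 0 else 0) +
        if x = x' then energy E2 θ2 (fun y => f (x, y)) y y' else 0 := by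
  by_cases hx : x = x' <;> by_cases hy : y = y'
  · subst hx hy
    simp [energy, prodE, h1, h2]
  · subst hx
    simp [energy, prodE, prodTheta, hy]
  · subst hy
    by_cases hI : y ∈ I <;> simp [energy, prodE, prodTheta, hx, hI]
  · simp [energy, prodE, hx, hy]

theorem quadForm_prod [Fintype V2] {E1 : V1 → V1 → ℝ} {m1 : V1 → ℝ} (θ1 : V1 → V1 → ℝ)
    {E2 : V2 → V2 → ℝ} {m2 : V2 → ℝ} (θ2 : V2 → V2 → ℝ) (I : Set V2)
    (hG1 : GraphAxioms E1 m1) (hG2 : GraphAxioms E2 m2)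
    {f : V1 × V2 → ℂ} (hf : (Function.support f).Finite) :
    quadForm (prodE E1 E2 I) (prodTheta θ1 θ2) f =
      fiberForm E2 θ2 f + horizontalForm E1 θ1 I f := by
  obtain ⟨S, hsub, hS⟩ := exists_finset_neighbors hG1 (hf.image Prod.fst)
  have hzero : ∀ x, x ∉ Prod.fst '' Function.support f → ∀ y, f (x, y) = 0 := by
    intro x hx y
    by_contra h
    exact hx ⟨(x, y), h, rfl⟩
  have hprod : ∀ p q, p ∉ S ×ˢ (Finset.univ : Finset V2) ∨ q ∉ S ×ˢ (Finset.univ : Finset V2) →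
      prodE E1 E2 I p q = 0 ∨ (f p = 0 ∧ f q = 0) := by
    rintro ⟨x, y⟩ ⟨x', y'⟩ h
    simp only [Finset.mem_product, Finset.mem_univ, and_true] at h
    rcases hS x x' h with h0 | ⟨h0, h0'⟩
    · by_cases hx : x = x'
      · subst hx
        have : x ∉ Prod.fst '' Function.support f := fun hx => (or_self_iff.1 h) (hsub hx)
        exact Or.inr ⟨hzero x this y, hzero x this y'⟩
      · left
        simp [prodE, h0, hx]
    · exact Or.inr ⟨hzero x h0 y, hzero x' h0' y'⟩
  have hfib : fiberForm E2 θ2 f = ∑ x ∈ S, quadForm E2 θ2 fun y => f (x, y) := by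
    refine tsum_eq_sum fun x hx => ?_
    have : (fun y => f (x, y)) = fun _ => 0 := funext (hzero x fun h => hx (hsub h))
    rw [this, quadForm_zero]
  have hslice : ∀ y, quadForm E1 θ1 (fun x => f (x, y)) =
      (1 / 2) * ∑ x ∈ S, ∑ x' ∈ S, energy E1 θ1 (fun x => f (x, y)) x x' := fun y =>
    quadForm_eq_sum θ1 fun x x' h =>
      (hS x x' h).imp_right fun h => ⟨hzero x h.1 y, hzero x' h.2 y⟩
  have hfiber : ∀ x, quadForm E2 θ2 (fun y => f (x, y)) =
      (1 / 2) * ∑ y, ∑ y', energy E2 θ2 (fun y => f (x, y)) y y' := fun x =>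
    quadForm_eq_sum θ2 (by simp)
  rw [quadForm_eq_sum _ hprod, hfib, horizontalForm]
  simp only [hslice, hfiber, Finset.sum_product, energy_prod I hG1.2.2.1 hG2.2.2.1,
    Finset.sum_add_distrib, Finset.sum_ite_eq, Finset.mem_univ, if_true, mul_add]
  rw [add_comm]
  congr 1
  · rw [← Finset.mul_sum]
    congr 1
    refine Finset.sum_congr rfl fun x hx => Finset.sum_congr rfl fun y _ => ?_
    rw [Finset.sum_comm]
    refine Finset.sum_congr rfl fun y' _ => ?_
    rw [Finset.sum_ite_eq, if_pos hx]
  · rw [Finset.sum_comm, Finset.mul_sum]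
    refine Finset.sum_congr rfl fun y _ => ?_
    split_ifs
    · rfl
    · simp

theorem fiberForm_nonneg {E2 : V2 → V2 → ℝ} (hE : ∀ x y, 0 ≤ E2 x y) (θ2 : V2 → V2 → ℝ)
    (f : V1 × V2 → ℂ) : 0 ≤ fiberForm E2 θ2 f :=
  tsum_nonneg fun _ => quadForm_nonneg hE θ2 _

theorem horizontalForm_nonneg [Fintype V2] {E1 : V1 → V1 → ℝ} (hE : ∀ x y, 0 ≤ E1 x y)
    (θ1 : V1 → V1 → ℝ) (I : Set V2) (f : V1 × V2 → ℂ) : 0 ≤ horizontalForm E1 θ1 I f :=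
  Finset.sum_nonneg fun y _ => by
    split_ifs
    exacts [quadForm_nonneg hE θ1 _, le_rfl]

theorem tsum_prod_mul_norm_sq [Fintype V2] (w : V1 × V2 → ℝ) {f : V1 × V2 → ℂ}
    (hf : (Function.support f).Finite) :
    ∑' p, w p * ‖f p‖ ^ 2 = ∑ y, ∑' x, w (x, y) * ‖f (x, y)‖ ^ 2 := by
  have hsub : Function.support f ⊆
      ((hf.image Prod.fst).toFinset ×ˢ Finset.univ : Finset (V1 × V2)) := by
    intro p hp
    simp only [Finset.coe_product, Set.Finite.coe_toFinset, Finset.coe_univ, Set.mem_prod,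
      Set.mem_univ, and_true]
    exact ⟨p, hp, rfl⟩
  have hsub' : ∀ y, (Function.support fun x => f (x, y)) ⊆ (hf.image Prod.fst).toFinset := by
    intro y x hx
    rw [Set.Finite.coe_toFinset]
    exact ⟨(x, y), hx, rfl⟩
  rw [tsum_mul_norm_sq_eq_sum w (S := (hf.image Prod.fst).toFinset ×ˢ Finset.univ)
      hsub, Finset.sum_product, Finset.sum_comm]
  exact Finset.sum_congr rfl fun y _ =>
    (tsum_mul_norm_sq_eq_sum (fun x => w (x, y)) (hsub' y)).symm

theorem summable_mul_norm_sq (w : V → ℝ) {f : V → ℂ} (hf : (Function.support f).Finite) :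
    Summable fun x => w x * ‖f x‖ ^ 2 :=
  summable_of_hasFiniteSupport (hf.subset fun x hx h => hx (by simp [h]))

theorem tsum_mul_norm_sq_le {w w' : V → ℝ} (h : ∀ x, w x ≤ w' x) {f : V → ℂ}
    (hf : (Function.support f).Finite) :
    ∑' x, w x * ‖f x‖ ^ 2 ≤ ∑' x, w' x * ‖f x‖ ^ 2 :=
  (summable_mul_norm_sq w hf).tsum_le_tsum
    (fun x => mul_le_mul_of_nonneg_right (h x) (by positivity)) (summable_mul_norm_sq w' hf)

theorem horizontalForm_le [Fintype V2] {E1 : V1 → V1 → ℝ} {m1 : V1 → ℝ} (θ1 : V1 → V1 → ℝ)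
    {m2 : V2 → ℝ} (I : Set V2) (hG1 : GraphAxioms E1 m1) {M : ℝ}
    (hM : ∀ x y, degree E1 m1 x ≤ M * m2 y) {f : V1 × V2 → ℂ}
    (hf : (Function.support f).Finite) :
    horizontalForm E1 θ1 I f ≤ 2 * M * nrmSq (prodM m1 m2) f := by
  rw [nrmSq, tsum_prod_mul_norm_sq _ hf, horizontalForm, Finset.mul_sum]
  refine Finset.sum_le_sum fun y _ => ?_
  have hdeg : 2 * degForm E1 m1 (fun x => f (x, y)) ≤
      2 * M * ∑' x, prodM m1 m2 (x, y) * ‖f (x, y)‖ ^ 2 := by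
    have h := tsum_mul_norm_sq_le (w := fun x => m1 x * degree E1 m1 x)
      (w' := fun x => M * prodM m1 m2 (x, y)) (fun x => by
        have := mul_le_mul_of_nonneg_left (hM x y) (hG1.2.2.2.1 x).le
        simp only [prodM]
        linarith) (finite_support_slice hf y)
    simp only [mul_assoc M, tsum_mul_left] at h
    unfold degForm
    linarith
  split_ifs
  · exact (quadForm_le_two_mul_degForm hG1 θ1 (finite_support_slice hf y)).trans hdeg
  · exact (mul_nonneg zero_le_two (degForm_nonneg hG1 _)).trans hdeg

theorem mul_tsum_le_fiberForm [Fintype V2] {E2 θ2 : V2 → V2 → ℝ} {c : ℝ}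
    (hc : ∀ g : V2 → ℂ, c * ∑ y, ‖g y‖ ^ 2 ≤ quadForm E2 θ2 g)
    {f : V1 × V2 → ℂ} (hf : (Function.support f).Finite) :
    ∑' p, c * ‖f p‖ ^ 2 ≤ fiberForm E2 θ2 f := by
  have hzero : ∀ x, x ∉ (hf.image Prod.fst).toFinset → ∀ y, f (x, y) = 0 := by
    intro x hx y
    by_contra h
    exact hx ((hf.image Prod.fst).mem_toFinset.2 ⟨(x, y), h, rfl⟩)
  have hfib : fiberForm E2 θ2 f =
      ∑ x ∈ (hf.image Prod.fst).toFinset, quadForm E2 θ2 fun y => f (x, y) := by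
    refine tsum_eq_sum fun x hx => ?_
    have : (fun y => f (x, y)) = fun _ => 0 := funext (hzero x hx)
    rw [this, quadForm_zero]
  rw [hfib, tsum_eq_sum (s := (hf.image Prod.fst).toFinset ×ˢ Finset.univ), Finset.sum_product]
  · refine Finset.sum_le_sum fun x _ => ?_
    rw [← Finset.mul_sum]
    exact hc _
  · rintro ⟨x, y⟩ hp
    rw [hzero x (fun h => hp (Finset.mem_product.2 ⟨h, Finset.mem_univ y⟩)) y]
    simp

theorem tsum_prodE [Fintype V2] {E1 : V1 → V1 → ℝ} {m1 : V1 → ℝ} (E2 : V2 → V2 → ℝ) (I : Set V2)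
    (hG1 : GraphAxioms E1 m1) (x : V1) (y : V2) :
    ∑' q, prodE E1 E2 I (x, y) q = (if y ∈ I then ∑' x', E1 x x' else 0) + ∑ y', E2 y y' := by
  have hS : ∀ x', x' ∉ insert x (hG1.2.2.2.2 x).toFinset → E1 x x' = 0 ∧ x ≠ x' := by
    intro x' hx'
    simp only [Finset.mem_insert, Set.Finite.mem_toFinset, Set.mem_ofPred_eq, not_or, not_lt] at hx'
    exact ⟨le_antisymm hx'.2 (hG1.2.1 x x'), Ne.symm hx'.1⟩
  rw [tsum_eq_sum (s := insert x (hG1.2.2.2.2 x).toFinset ×ˢ Finset.univ), Finset.sum_product,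
    tsum_eq_sum (s := insert x (hG1.2.2.2.2 x).toFinset) fun x' hx' => (hS x' hx').1]
  · simp only [prodE, Finset.sum_add_distrib]
    congr 1
    · by_cases hy : y ∈ I <;> simp [hy]
    · rw [Finset.sum_comm]
      simp
  · rintro ⟨x', y'⟩ hp
    have := hS x' fun h => hp (Finset.mem_product.2 ⟨h, Finset.mem_univ y'⟩)
    simp [prodE, this.1, this.2]

theorem degForm_prod_le [Fintype V2] {E1 : V1 → V1 → ℝ} {m1 : V1 → ℝ}
    {E2 : V2 → V2 → ℝ} {m2 : V2 → ℝ} {θ2 : V2 → V2 → ℝ} (I : Set V2)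
    (hG1 : GraphAxioms E1 m1) (hG2 : GraphAxioms E2 m2) {M : ℝ}
    (hM : ∀ x y, degree E1 m1 x ≤ M * m2 y) {c : ℝ} (hc0 : 0 < c)
    (hc : ∀ g : V2 → ℂ, c * ∑ y, ‖g y‖ ^ 2 ≤ quadForm E2 θ2 g)
    {f : V1 × V2 → ℂ} (hf : (Function.support f).Finite) :
    degForm (prodE E1 E2 I) (prodM m1 m2) f ≤
      M * nrmSq (prodM m1 m2) f + (∑ y, ∑ y', E2 y y') / c * fiberForm E2 θ2 f := by
  have hC : 0 ≤ ∑ y, ∑ y', E2 y y' :=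
    Finset.sum_nonneg fun y _ => Finset.sum_nonneg fun y' _ => hG2.2.1 y y'
  have hw : ∀ p : V1 × V2, prodM m1 m2 p * degree (prodE E1 E2 I) (prodM m1 m2) p ≤
      M * prodM m1 m2 p + ∑ y, ∑ y', E2 y y' := by
    rintro ⟨x, y⟩
    rw [mul_degree (graphAxioms_prod I hG1 hG2).2.2.2.1, tsum_prodE E2 I hG1]
    have h1 : ∑' x', E1 x x' ≤ M * prodM m1 m2 (x, y) := by
      rw [← mul_degree hG1.2.2.2.1]
      have := mul_le_mul_of_nonneg_left (hM x y) (hG1.2.2.2.1 x).le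
      simp only [prodM]
      linarith
    have h2 : 0 ≤ ∑' x', E1 x x' := tsum_nonneg (hG1.2.1 x)
    refine add_le_add ?_ (Finset.single_le_sum (f := fun y => ∑ y', E2 y y')
      (fun y _ => Finset.sum_nonneg fun y' _ => hG2.2.1 y y') (Finset.mem_univ y))
    split_ifs
    exacts [h1, h2.trans h1]
  have h := tsum_mul_norm_sq_le hw hf
  have hsplit : ∑' p, (M * prodM m1 m2 p + ∑ y, ∑ y', E2 y y') * ‖f p‖ ^ 2 =
      M * nrmSq (prodM m1 m2) f + (∑ y, ∑ y', E2 y y') / c * ∑' p, c * ‖f p‖ ^ 2 := by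
    rw [nrmSq, ← tsum_mul_left, ← tsum_mul_left, ← Summable.tsum_add
      ((summable_mul_norm_sq _ hf).mul_left _) ((summable_mul_norm_sq (fun _ => c) hf).mul_left _)]
    refine tsum_congr fun p => ?_
    field_simp
  rw [hsplit] at h
  have := mul_le_mul_of_nonneg_left (mul_tsum_le_fiberForm hc hf) (div_nonneg hC hc0.le)
  unfold degForm
  linarith

/-! Min-max comparison of forms. -/

theorem finite_support_of_mem_span {n : ℕ} {g : Fin n → V → ℂ}
    (hg : ∀ i, (Function.support (g i)).Finite) {f : V → ℂ}
    (hf : f ∈ Submodule.span ℂ (Set.range g)) : (Function.support f).Finite := by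
  induction hf using Submodule.span_induction with
  | mem f hf =>
    obtain ⟨i, rfl⟩ := hf
    exact hg i
  | zero => simp
  | add f f' _ _ h h' => exact (h.union h').subset (Function.support_add f f')
  | smul c f _ h => exact h.subset (Function.support_const_smul_subset c f)

theorem DimGE.mono {Q Q' : (V → ℂ) → ℝ} {m : V → ℝ} {lam lam' : ℝ} {n : ℕ}
    (h : DimGE Q m lam n)
    (hQ : ∀ f : V → ℂ, (Function.support f).Finite → Q f ≤ lam * nrmSq m f →
      Q' f ≤ lam' * nrmSq m f) : DimGE Q' m lam' n := by
  obtain ⟨g, hli, hfin, hle⟩ := h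
  exact ⟨g, hli, hfin, fun f hf => hQ f (finite_support_of_mem_span hfin hf) (hle f hf)⟩

theorem countEig_le {Q Q' : (V → ℂ) → ℝ} {m : V → ℝ} {lam lam' : ℝ}
    (hQ' : CompactResolvent Q' m) (h : ∀ k, DimGE Q m lam k → DimGE Q' m lam' k) :
    countEig Q m lam ≤ countEig Q' m lam' := by
  obtain ⟨n, hn⟩ := hQ' lam'
  unfold countEig
  rcases Set.eq_empty_or_nonempty {k | DimGE Q m lam k} with h0 | h0
  · simp [h0]
  · exact csSup_le_csSup ⟨n, hn⟩ h0 h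

theorem nrmSq_pos {m : V → ℝ} (hm : ∀ x, 0 < m x) {f : V → ℂ}
    (hf : (Function.support f).Finite) (h0 : f ≠ 0) : 0 < nrmSq m f := by
  obtain ⟨x, hx⟩ := Function.ne_iff.1 h0
  refine (summable_mul_norm_sq m hf).tsum_pos
    (fun x => mul_nonneg (hm x).le (by positivity)) x (mul_pos (hm x) ?_)
  exact pow_pos (norm_pos_iff.2 hx) 2

theorem DimGE.nonneg {Q : (V → ℂ) → ℝ} (hQ : ∀ f, 0 ≤ Q f) {m : V → ℝ} (hm : ∀ x, 0 < m x)
    {t : ℝ} {n : ℕ} (h : DimGE Q m t (n + 1)) : 0 ≤ t := by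
  obtain ⟨g, hli, hfin, hle⟩ := h
  have h1 := (hQ _).trans (hle (g 0) (Submodule.subset_span ⟨0, rfl⟩))
  exact nonneg_of_mul_nonneg_left h1 (nrmSq_pos hm (hfin 0) (hli.ne_zero 0))

theorem exists_dimGE_quadForm [Infinite V] {E : V → V → ℝ} {m : V → ℝ} (hG : GraphAxioms E m)
    (θ : V → V → ℝ) (n : ℕ) : ∃ t, DimGE (quadForm E θ) m t n := by
  let e : Fin n ↪ V := Fin.valEmbedding.trans (Infinite.natEmbedding V)
  have hsupp : ∀ f ∈ Submodule.span ℂ (Set.range fun i => (Pi.single (e i) 1 : V → ℂ)),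
      ∀ x, x ∉ Set.range e → f x = 0 := by
    intro f hf x hx
    induction hf using Submodule.span_induction with
    | mem f hf =>
      obtain ⟨i, rfl⟩ := hf
      exact Pi.single_eq_of_ne (fun h => hx ⟨i, h.symm⟩) _
    | zero => rfl
    | add f f' _ _ h h' => simp [h, h']
    | smul c f _ h => simp [h]
  have hfin : ∀ i, (Function.support (Pi.single (e i) 1 : V → ℂ)).Finite := fun i =>
    (Set.finite_singleton (e i)).subset (Pi.support_single_subset)
  refine ⟨2 * ∑ i, degree E m (e i), fun i => Pi.single (e i) 1,
    (Pi.linearIndependent_single_one V ℂ).comp e e.injective, hfin, fun f hf => ?_⟩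
  have hff := finite_support_of_mem_span hfin hf
  have h1 := quadForm_le_two_mul_degForm hG θ hff
  have h2 : degForm E m f ≤ (∑ i, degree E m (e i)) * nrmSq m f := by
    rw [degForm, nrmSq, ← tsum_mul_left]
    refine (summable_mul_norm_sq _ hff).tsum_le_tsum (fun x => ?_)
      ((summable_mul_norm_sq m hff).mul_left _)
    by_cases hx : x ∈ Set.range e
    · obtain ⟨i, rfl⟩ := hx
      have h3 : degree E m (e i) ≤ ∑ i, degree E m (e i) :=
        Finset.single_le_sum (f := fun i => degree E m (e i))
          (fun i _ => degree_nonneg hG (e i)) (Finset.mem_univ i)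
      have h4 : 0 ≤ m (e i) * ‖f (e i)‖ ^ 2 := mul_nonneg (hG.2.2.2.1 _).le (by positivity)
      have := mul_le_mul_of_nonneg_right h3 h4
      linarith
    · simp [hsupp f hf x hx]
  linarith

theorem compactResolvent_fiberForm [Fintype V2] {m1 : V1 → ℝ} {m2 : V2 → ℝ}
    (hm2 : ∀ y, 0 < m2 y) (hH1 : H1cond m1) {E2 θ2 : V2 → V2 → ℝ} {c : ℝ}
    (hc0 : 0 < c) (hc : ∀ g : V2 → ℂ, c * ∑ y, ‖g y‖ ^ 2 ≤ quadForm E2 θ2 g)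
    (hm1 : ∀ x, 0 < m1 x) :
    CompactResolvent (fiberForm (V1 := V1) E2 θ2) (prodM m1 m2) := by
  intro lam
  have hB : 0 < ∑ y, m2 y + 1 := by
    have := Finset.sum_nonneg fun y (_ : y ∈ Finset.univ) => (hm2 y).le
    linarith
  set ε := c / ((|lam| + 1) * (∑ y, m2 y + 1)) with hε
  have hlam : 0 < |lam| + 1 := by positivity
  have hF := hH1.2 ε (by positivity)
  have : Fintype {x : V1 | ε ≤ m1 x} := hF.fintype
  have hsmall : ∀ x, ¬ ε ≤ m1 x → ∀ y, lam * prodM m1 m2 (x, y) < c := by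
    intro x hx y
    have h1 : m2 y ≤ ∑ y, m2 y + 1 := by
      have := Finset.single_le_sum (f := m2) (fun y _ => (hm2 y).le) (Finset.mem_univ y)
      linarith
    have h2 : m1 x * ((|lam| + 1) * (∑ y, m2 y + 1)) < c := by
      rw [not_le, hε, lt_div_iff₀ (by positivity)] at hx
      exact hx
    refine lt_of_le_of_lt ?_ h2
    calc lam * (m1 x * m2 y) ≤ (|lam| + 1) * (m1 x * (∑ y, m2 y + 1)) := by
          have := hm1 x
          have := hm2 y
          gcongr
          linarith [le_abs_self lam]
      _ = _ := by ring
  refine ⟨Fintype.card ({x : V1 | ε ≤ m1 x} × V2), fun k ⟨g, hli, hfin, hle⟩ => ?_⟩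
  let R : (V1 × V2 → ℂ) →ₗ[ℂ] ({x : V1 | ε ≤ m1 x} × V2 → ℂ) :=
    LinearMap.funLeft ℂ ℂ fun p => (p.1.1, p.2)
  have hdisj : Disjoint (Submodule.span ℂ (Set.range g)) (LinearMap.ker R) := by
    rw [Submodule.disjoint_def]
    intro f hf hR
    have hff := finite_support_of_mem_span hfin hf
    have hvan : ∀ x y, ε ≤ m1 x → f (x, y) = 0 := fun x y hx =>
      congrFun (LinearMap.mem_ker.1 hR) (⟨x, hx⟩, y)
    have h1 := (mul_tsum_le_fiberForm hc hff).trans (hle f hf)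
    rw [nrmSq, ← tsum_mul_left] at h1
    have hterm : ∀ p, lam * (prodM m1 m2 p * ‖f p‖ ^ 2) ≤ c * ‖f p‖ ^ 2 := by
      rintro ⟨x, y⟩
      by_cases hx : ε ≤ m1 x
      · simp [hvan x y hx]
      · rw [← mul_assoc]
        exact mul_le_mul_of_nonneg_right (hsmall x hx y).le (by positivity)
    by_contra h0
    obtain ⟨⟨x, y⟩, hxy⟩ := Function.ne_iff.1 h0
    have hx : ¬ ε ≤ m1 x := fun hx => hxy (hvan x y hx)
    refine absurd h1 (not_le.2 (Summable.tsum_lt_tsum (i := (x, y)) hterm ?_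
      ((summable_mul_norm_sq _ hff).mul_left _) (summable_mul_norm_sq (fun _ => c) hff)))
    rw [← mul_assoc]
    exact mul_lt_mul_of_pos_right (hsmall x hx y) (pow_pos (norm_pos_iff.2 hxy) 2)
  have := (hli.map hdisj).fintype_card_le_finrank
  simpa using this

theorem tendsto_eigVal_atTop {Q : (V → ℂ) → ℝ} {m : V → ℝ} (hm : ∀ x, 0 < m x)
    (hQ : CompactResolvent Q m) (hne : ∀ n, ∃ t, DimGE Q m t n) :
    Filter.Tendsto (eigVal Q m) Filter.atTop Filter.atTop := by
  refine Filter.tendsto_atTop.2 fun lam => ?_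
  obtain ⟨N, hN⟩ := hQ lam
  filter_upwards [Filter.eventually_ge_atTop N] with n hn
  refine le_csInf (hne (n + 1)) fun t ht => ?_
  by_contra! hlt
  have := hN (n + 1) (DimGE.mono ht fun f _ h =>
    h.trans (mul_le_mul_of_nonneg_right hlt.le (nrmSq_nonneg hm f)))
  omega

/-- The eigenvalues of two forms differing by at most `C ‖·‖²` are asymptotically equivalent,
provided they tend to infinity. -/
theorem tendsto_eigVal_div {Q Q' : (V → ℂ) → ℝ} {m : V → ℝ} (hm : ∀ x, 0 < m x) {C : ℝ}
    (hQ' : ∀ f, 0 ≤ Q' f) (hres : CompactResolvent Q' m) (hne : ∀ n, ∃ t, DimGE Q' m t n)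
    (hle : ∀ f : V → ℂ, (Function.support f).Finite → Q' f ≤ Q f)
    (hle' : ∀ f : V → ℂ, (Function.support f).Finite → Q f ≤ Q' f + C * nrmSq m f) :
    Filter.Tendsto (fun n => eigVal Q m n / eigVal Q' m n) Filter.atTop (nhds 1) := by
  have hup : ∀ t n, DimGE Q' m t n → DimGE Q m (t + C) n := fun t n h =>
    h.mono fun f hf h => (hle' f hf).trans (by linarith)
  have hdown : ∀ t n, DimGE Q m t n → DimGE Q' m t n := fun t n h =>
    h.mono fun f hf h => (hle f hf).trans h
  have hbdd' : ∀ n, BddBelow {t | DimGE Q' m t (n + 1)} := fun n =>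
    ⟨0, fun t ht => DimGE.nonneg hQ' hm ht⟩
  have hbdd : ∀ n, BddBelow {t | DimGE Q m t (n + 1)} := fun n =>
    (hbdd' n).mono fun t ht => hdown t _ ht
  have h1 : ∀ n, eigVal Q' m n ≤ eigVal Q m n := fun n =>
    csInf_le_csInf (hbdd' n) ((hne (n + 1)).imp' _ fun t ht => hup t _ ht) fun t ht => hdown t _ ht
  have h2 : ∀ n, eigVal Q m n ≤ eigVal Q' m n + C := fun n => by
    rw [← sub_le_iff_le_add]
    refine le_csInf (hne (n + 1)) fun t ht => ?_
    rw [sub_le_iff_le_add]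
    exact csInf_le (hbdd n) (hup t _ ht)
  have htop := tendsto_eigVal_atTop hm hres hne
  have hlim : Filter.Tendsto (fun n => 1 + C / eigVal Q' m n) Filter.atTop (nhds 1) := by
    simpa using (htop.const_div_atTop C).const_add 1
  refine tendsto_of_tendsto_of_tendsto_of_le_of_le' tendsto_const_nhds hlim ?_ ?_
  · filter_upwards [htop.eventually_gt_atTop 0] with n hn
    exact (one_le_div hn).2 (h1 n)
  · filter_upwards [htop.eventually_gt_atTop 0] with n hn
    rw [div_le_iff₀ hn, add_mul, one_mul, div_mul_cancel₀ _ hn.ne']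
    exact h2 n

/-- For a discrete cusp `G = G1 ×_I G2` with `Hol_{θ2} ≠ 0` and
`M = (sup deg_{G1}) · (max 1/m2)`: the form domains of `Δ_{G,θ}` and `deg_G(·)`
coincide, `N_{λ-2M}(m1⁻¹ ⊗ Δ_{G2,θ2}) ≤ N_λ(Δ_{G,θ}) ≤ N_λ(m1⁻¹ ⊗ Δ_{G2,θ2})`
for all `λ ≥ 0`, and `λ_n(Δ_{G,θ})/λ_n(m1⁻¹ ⊗ Δ_{G2,θ2}) → 1`. -/
theorem cusp_eigenvalue_asymptotics
    [Fintype V2]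
    (E1 : V1 → V1 → ℝ) (m1 : V1 → ℝ) (θ1 : V1 → V1 → ℝ)
    (E2 : V2 → V2 → ℝ) (m2 : V2 → ℝ) (θ2 : V2 → V2 → ℝ)
    (I : Set V2) (hI : I.Nonempty)
    (hG1 : GraphAxioms E1 m1) (hG2 : GraphAxioms E2 m2)
    (hθ1 : MagneticPotential E1 θ1) (hθ2 : MagneticPotential E2 θ2)
    (hconn1 : Conn E1) (hconn2 : Conn E2)
    (hH1 : H1cond m1) (hH3 : H3cond E1 m1)
    (hhol : ¬HolTrivial E2 θ2)
    (M : ℝ) (hM : M = (⨆ x, degree E1 m1 x) * ⨆ y, (m2 y)⁻¹) :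
    SameFormDomain (quadForm (prodE E1 E2 I) (prodTheta θ1 θ2))
        (degForm (prodE E1 E2 I) (prodM m1 m2)) (prodM m1 m2) ∧
      (∀ lam : ℝ, 0 ≤ lam →
        countEig (fiberForm (V1 := V1) E2 θ2) (prodM m1 m2) (lam - 2 * M) ≤
            countEig (quadForm (prodE E1 E2 I) (prodTheta θ1 θ2)) (prodM m1 m2) lam ∧
          countEig (quadForm (prodE E1 E2 I) (prodTheta θ1 θ2)) (prodM m1 m2) lam ≤
            countEig (fiberForm (V1 := V1) E2 θ2) (prodM m1 m2) lam) ∧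
      Filter.Tendsto (fun n : ℕ =>
          eigVal (quadForm (prodE E1 E2 I) (prodTheta θ1 θ2)) (prodM m1 m2) n /
            eigVal (fiberForm (V1 := V1) E2 θ2) (prodM m1 m2) n)
        Filter.atTop (nhds 1) := by
  obtain ⟨y₀, -⟩ := hI
  have : Nonempty V2 := ⟨y₀⟩
  have : Infinite V1 := hH1.1
  have hG := graphAxioms_prod I hG1 hG2
  obtain ⟨c, hc0, hc⟩ := exists_pos_mul_sum_le_quadForm hG2 hconn2 hhol
  have hbdd : BddAbove (Set.range fun x => degree E1 m1 x) := by
    obtain ⟨d, hd⟩ := hH3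
    exact ⟨d, by rintro _ ⟨x, rfl⟩; exact hd x⟩
  have hsup0 : 0 ≤ ⨆ x, degree E1 m1 x := Real.iSup_nonneg (degree_nonneg hG1)
  have hinv0 : 0 ≤ ⨆ y, (m2 y)⁻¹ := Real.iSup_nonneg fun y => (inv_pos.2 (hG2.2.2.2.1 y)).le
  have hM0 : 0 ≤ M := hM ▸ mul_nonneg hsup0 hinv0
  have hMdeg : ∀ x y, degree E1 m1 x ≤ M * m2 y := by
    intro x y
    have h1 : 1 ≤ (⨆ y, (m2 y)⁻¹) * m2 y := by
      rw [← inv_le_iff_one_le_mul₀ (hG2.2.2.2.1 y)]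
      exact le_ciSup (f := fun y => (m2 y)⁻¹) (Set.finite_range _).bddAbove y
    calc degree E1 m1 x ≤ ⨆ x, degree E1 m1 x := le_ciSup hbdd x
      _ ≤ (⨆ x, degree E1 m1 x) * ((⨆ y, (m2 y)⁻¹) * m2 y) := le_mul_of_one_le_right hsup0 h1
      _ = M * m2 y := by rw [hM, mul_assoc]
  have hlower : ∀ f : V1 × V2 → ℂ, (Function.support f).Finite →
      fiberForm E2 θ2 f ≤ quadForm (prodE E1 E2 I) (prodTheta θ1 θ2) f := fun f hf => by
    rw [quadForm_prod θ1 θ2 I hG1 hG2 hf]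
    linarith [horizontalForm_nonneg hG1.2.1 θ1 I f]
  have hupper : ∀ f : V1 × V2 → ℂ, (Function.support f).Finite →
      quadForm (prodE E1 E2 I) (prodTheta θ1 θ2) f ≤
        fiberForm E2 θ2 f + 2 * M * nrmSq (prodM m1 m2) f := fun f hf => by
    rw [quadForm_prod θ1 θ2 I hG1 hG2 hf]
    linarith [horizontalForm_le (m2 := m2) θ1 I hG1 hMdeg hf]
  have hres : CompactResolvent (fiberForm (V1 := V1) E2 θ2) (prodM m1 m2) :=
    compactResolvent_fiberForm hG2.2.2.2.1 hH1 hc0 hc hG1.2.2.2.1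
  have hdown : ∀ t k, DimGE (quadForm (prodE E1 E2 I) (prodTheta θ1 θ2)) (prodM m1 m2) t k →
      DimGE (fiberForm (V1 := V1) E2 θ2) (prodM m1 m2) t k := fun t k h =>
    h.mono fun f hf h => (hlower f hf).trans h
  refine ⟨?_, fun lam _ => ⟨?_, countEig_le hres (hdown lam)⟩, ?_⟩
  · have hC : 0 ≤ (∑ y, ∑ y', E2 y y') / c := div_nonneg
      (Finset.sum_nonneg fun y _ => Finset.sum_nonneg fun y' _ => hG2.2.1 y y') hc0.le
    refine ⟨1 / 2, 1 + M + (∑ y, ∑ y', E2 y y') / c, by norm_num, by linarith, fun f hf => ?_⟩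
    have hn := nrmSq_nonneg hG.2.2.2.1 f
    have hq := quadForm_nonneg hG.2.1 (prodTheta θ1 θ2) f
    have h1 := quadForm_le_two_mul_degForm hG (prodTheta θ1 θ2) hf
    have h2 := degForm_prod_le I hG1 hG2 hMdeg hc0 hc hf
    have h3 := mul_le_mul_of_nonneg_left (hlower f hf) hC
    refine ⟨by linarith, ?_⟩
    nlinarith [mul_nonneg hM0 hq, mul_nonneg hC hn]
  · refine countEig_le (fun t => ?_) fun k h => h.mono fun f hf h => (hupper f hf).trans ?_
    · exact (hres t).imp fun n hn k hk => hn k (hdown t k hk)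
    · linarith
  · exact tendsto_eigVal_div hG.2.2.2.1 (fiberForm_nonneg hG2.2.1 θ2) hres
      (fun n => (exists_dimGE_quadForm hG _ n).imp fun t ht => hdown t n ht) hlower hupper

end MagneticCusp
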